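/- arXiv:2108.12379 — 9 statements merged into one kernel-verified Lean document; each statement's English description precedes it below -/
import Mathlib

section
/- Let ⪯ be an artinian preorder on a monoid H and let s be an integer ≥ 2. Then every ⪯-non-unit x ∈ H factors as a non-empty finite product of ⪯-irreducibles of degree s; moreover, if the ⪯-height of x equals a finite number N, then x factors as a product of at most s^(N−1) ⪯-irreducibles of degree s. -/
/-- `u` is a `⪯`-unit of the monoid `H`: `u ⪯ 1` and `1 ⪯ u`. -/
def IsPreUnit {H : Type*} [Monoid H] (le : H → H → Prop) (u : H) : Prop :=
  le u 1 ∧ le 1 u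

/-- The strict relation associated with the preorder `le`: `x ≺ y`. -/
def PreLt {H : Type*} [Monoid H] (le : H → H → Prop) (x y : H) : Prop :=
  le x y ∧ ¬ le y x

/-- `a` is a `⪯`-irreducible of degree `s`: a `⪯`-non-unit which, for no `k` with
`2 ≤ k ≤ s`, can be written as a product of `k` `⪯`-non-units each strictly smaller
than `a` with respect to `⪯`. -/
def IsPreIrred {H : Type*} [Monoid H] (le : H → H → Prop) (s : ℕ) (a : H) : Prop :=
  ¬ IsPreUnit le a ∧
    ∀ l : List H, 2 ≤ l.length → l.length ≤ s →
      (∀ b ∈ l, ¬ IsPreUnit le b ∧ PreLt le b a) → l.prod ≠ a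

/-- The `⪯`-height of `x`: the supremum in `ℕ∞` (with `sSup ∅ = 0`) of the set of
integers `n ≥ 1` for which there is a sequence `x₁, …, xₙ` of `⪯`-non-units with
`x₁ = x` and `x_{k+1} ≺ x_k` for `1 ≤ k ≤ n-1`. -/
noncomputable def preHgt {H : Type*} [Monoid H] (le : H → H → Prop) (x : H) : ℕ∞ :=
  sSup ((fun n : ℕ => (n : ℕ∞)) ''
    {n : ℕ | 1 ≤ n ∧ ∃ f : ℕ → H, f 1 = x ∧
      (∀ i, 1 ≤ i → i ≤ n → ¬ IsPreUnit le (f i)) ∧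
      (∀ i, 1 ≤ i → i < n → PreLt le (f (i + 1)) (f i))})

theorem natCast_le_preHgt {H : Type*} [Monoid H] {le : H → H → Prop} {x : H} {n : ℕ}
    (hn : 1 ≤ n) (f : ℕ → H) (h1 : f 1 = x)
    (hu : ∀ i, 1 ≤ i → i ≤ n → ¬ IsPreUnit le (f i))
    (hd : ∀ i, 1 ≤ i → i < n → PreLt le (f (i + 1)) (f i)) :
    (n : ℕ∞) ≤ preHgt le x :=
  le_sSup ⟨n, ⟨hn, f, h1, hu, hd⟩, rfl⟩

theorem one_le_preHgt {H : Type*} [Monoid H] {le : H → H → Prop} {x : H}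
    (hx : ¬ IsPreUnit le x) : 1 ≤ preHgt le x := by
  exact_mod_cast natCast_le_preHgt (n := 1) le_rfl (fun _ => x) rfl (fun _ _ _ => hx)
    (fun i hi hi' => by omega)

theorem preHgt_le_of_preLt {H : Type*} [Monoid H] {le : H → H → Prop} {x b : H} {N : ℕ}
    (hx : ¬ IsPreUnit le x) (hbx : PreLt le b x) (hN : preHgt le x = (N : ℕ∞)) :
    preHgt le b ≤ ((N - 1 : ℕ) : ℕ∞) := by
  refine sSup_le ?_
  rintro _ ⟨n, ⟨hn, f, h1, hu, hd⟩, rfl⟩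
  have key : ((n + 1 : ℕ) : ℕ∞) ≤ preHgt le x := by
    refine natCast_le_preHgt (by omega) (fun i => if i ≤ 1 then x else f (i - 1)) (by simp) ?_ ?_
    · intro i hi hin
      by_cases h : i ≤ 1
      · simpa [h] using hx
      · simpa [h] using hu (i - 1) (by omega) (by omega)
    · intro i hi hin
      by_cases h : i ≤ 1
      · obtain rfl : i = 1 := by omega
        simpa [h1] using hbx
      · obtain ⟨j, rfl⟩ : ∃ j, i = j + 1 := ⟨i - 1, by omega⟩
        have hj : j ≠ 0 := by omega
        simpa [hj] using hd j (by omega) (by omega)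
  rw [hN] at key
  have : n + 1 ≤ N := by exact_mod_cast key
  exact Nat.cast_le.2 (by omega)

theorem wellFounded_preLt {H : Type*} [Monoid H] {le : H → H → Prop}
    (hart : ¬ ∃ f : ℕ → H, ∀ k, PreLt le (f (k + 1)) (f k)) : WellFounded (PreLt le) :=
  wellFounded_iff_isEmpty_descending_chain.2 ⟨fun f => hart ⟨f.1, f.2⟩⟩

/-- If `⪯` is an artinian preorder on a monoid `H` and `s ≥ 2`, then
every `⪯`-non-unit `x` factors as a non-empty finite product of `⪯`-irreducibles of
degree `s`; moreover, if the `⪯`-height of `x` equals a finite `N`, the factorization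
can be taken with at most `s ^ (N - 1)` factors. -/
theorem abstract_factorization_artinian {H : Type*} [Monoid H] (le : H → H → Prop)
    (hrefl : ∀ x, le x x) (htrans : ∀ x y z, le x y → le y z → le x z)
    (hart : ¬ ∃ f : ℕ → H, ∀ k, PreLt le (f (k + 1)) (f k))
    (s : ℕ) (hs : 2 ≤ s) (x : H) (hx : ¬ IsPreUnit le x) :
    ∃ l : List H, l ≠ [] ∧ (∀ a ∈ l, IsPreIrred le s a) ∧ l.prod = x ∧
      ∀ N : ℕ, preHgt le x = (N : ℕ∞) → l.length ≤ s ^ (N - 1) := by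
  induction x using (wellFounded_preLt hart).induction with
  | _ x ih =>
  by_cases hirr : IsPreIrred le s x
  · exact ⟨[x], by simp, by simpa using hirr, by simp,
      fun N _ => by simpa using Nat.one_le_pow _ _ (by omega)⟩
  obtain ⟨l, hl2, hls, hl, hprod⟩ : ∃ l : List H, 2 ≤ l.length ∧ l.length ≤ s ∧
      (∀ b ∈ l, ¬ IsPreUnit le b ∧ PreLt le b x) ∧ l.prod = x := by
    by_contra! h
    exact hirr ⟨hx, h⟩
  have hfac : ∀ b, ∃ m : List H, b ∈ l → m ≠ [] ∧ (∀ a ∈ m, IsPreIrred le s a) ∧ m.prod = b ∧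
      ∀ N : ℕ, preHgt le b = (N : ℕ∞) → m.length ≤ s ^ (N - 1) := by
    intro b
    by_cases hb : b ∈ l
    · obtain ⟨m, hm⟩ := ih b (hl b hb).2 (hl b hb).1
      exact ⟨m, fun _ => hm⟩
    · exact ⟨[], fun h => absurd h hb⟩
  choose F hF using hfac
  refine ⟨l.flatMap F, ?_, ?_, ?_, ?_⟩
  · obtain ⟨b, hb⟩ := List.exists_mem_of_length_pos (by omega : 0 < l.length)
    intro h
    exact (hF b hb).1 (List.flatMap_eq_nil_iff.1 h b hb)
  · intro a ha
    obtain ⟨b, hb, hab⟩ := List.mem_flatMap.1 ha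
    exact (hF b hb).2.1 a hab
  · rw [List.flatMap_def, List.prod_flatten, List.map_map, ← hprod]
    congr 1
    exact (List.map_congr_left fun b hb => (hF b hb).2.2.1).trans (List.map_id' l)
  · intro N hN
    have hbound : ∀ b ∈ l, 2 ≤ N ∧ (F b).length ≤ s ^ (N - 2) := by
      intro b hb
      have hle := preHgt_le_of_preLt hx (hl b hb).2 hN
      have hge := one_le_preHgt (hl b hb).1
      obtain ⟨M, hM⟩ := ENat.ne_top_iff_exists.1 (ne_top_of_le_ne_top (ENat.natCast_ne_top _) hle)
      rw [← hM] at hle hge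
      have hle' : M ≤ N - 1 := by exact_mod_cast hle
      have hge' : 1 ≤ M := by exact_mod_cast hge
      exact ⟨by omega, ((hF b hb).2.2.2 M hM.symm).trans
        (Nat.pow_le_pow_right (by omega) (by omega))⟩
    obtain ⟨b, hb⟩ := List.exists_mem_of_length_pos (by omega : 0 < l.length)
    have hN2 := (hbound b hb).1
    have hsum := List.sum_le_card_nsmul (l.map fun b => (F b).length) (s ^ (N - 2)) (by
      intro c hc
      obtain ⟨b, hb, rfl⟩ := List.mem_map.1 hc
      exact (hbound b hb).2)
    rw [List.length_flatMap]
    calc _ ≤ l.length * s ^ (N - 2) := by simpa using hsum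
      _ ≤ s * s ^ (N - 2) := Nat.mul_le_mul_right _ hls
      _ = s ^ (N - 1) := by rw [← pow_succ', show N - 2 + 1 = N - 1 by omega]
end

section
/- Let R be an associative unital nonzero ring, a ∈ R, and e ∈ R an idempotent with ae = 0 (i.e., e lies in the right annihilator of a). Set b := e + (1−e)a and c := (1−e) + ea. Then a = bc, c is idempotent, eR = rann(c), the right ideal eR is contained in rfix(b), rfix(a) is contained in both rfix(b) and rfix(c), and rann(a) ∩ (1−e)R is contained in both rann(b) and rfix(c). -/
/-- The right annihilator `rann(a) = {x : a*x = 0}` of `a`, as a right ideal of `R`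
(i.e. a submodule of `R` viewed as a right module over itself, encoded as a module
over `Rᵐᵒᵖ`). -/
def rAnn (R : Type*) [Ring R] (a : R) : Submodule Rᵐᵒᵖ R where
  carrier := {x | a * x = 0}
  add_mem' := by
    intro x y hx hy
    simp only [Set.mem_setOf_eq] at *
    rw [mul_add, hx, hy, add_zero]
  zero_mem' := by simp
  smul_mem' := by
    intro c x hx
    simp only [Set.mem_setOf_eq] at *
    show a * (x * c.unop) = 0
    rw [← mul_assoc, hx, zero_mul]

/-- `rfix(a) = rann(1-a) = {x : a*x = x}`, as a right ideal of `R`. -/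
def rFix (R : Type*) [Ring R] (a : R) : Submodule Rᵐᵒᵖ R where
  carrier := {x | a * x = x}
  add_mem' := by
    intro x y hx hy
    simp only [Set.mem_setOf_eq] at *
    rw [mul_add, hx, hy]
  zero_mem' := by simp
  smul_mem' := by
    intro c x hx
    simp only [Set.mem_setOf_eq] at *
    show a * (x * c.unop) = x * c.unop
    rw [← mul_assoc, hx]

/-- The principal right ideal `aR = {a*y : y ∈ R}`. -/
def rPrin (R : Type*) [Ring R] (a : R) : Submodule Rᵐᵒᵖ R where
  carrier := {x | ∃ y, x = a * y}
  add_mem' := by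
    rintro x y ⟨u, rfl⟩ ⟨v, rfl⟩
    exact ⟨u + v, (mul_add a u v).symm⟩
  zero_mem' := ⟨0, (mul_zero a).symm⟩
  smul_mem' := by
    rintro c x ⟨u, rfl⟩
    exact ⟨u * c.unop, by show a * u * c.unop = a * (u * c.unop); rw [mul_assoc]⟩

/-- A right ideal `N` of `R` is indecomposable if it is nonzero and is not the
(internal) direct sum of two nonzero right ideals. -/
def IndecRId {R : Type*} [Ring R] (N : Submodule Rᵐᵒᵖ R) : Prop :=
  N ≠ ⊥ ∧ ¬ ∃ N₁ N₂ : Submodule Rᵐᵒᵖ R, N₁ ≠ ⊥ ∧ N₂ ≠ ⊥ ∧ N₁ ⊓ N₂ = ⊥ ∧ N₁ ⊔ N₂ = N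

/-- Membership in the monoid `H` of left zero divisors of `R` together with `1`. -/
def IsLeftZDOrOne (R : Type*) [Ring R] (a : R) : Prop :=
  (∃ y : R, y ≠ 0 ∧ a * y = 0) ∨ a = 1

/-- `a` is a unit for the rFix-preorder (`a ⪯ 1` and `1 ⪯ a`, where `x ⪯ y` iff
`rfix(y) ⊆ rfix(x)`). -/
def IsRFixUnit (R : Type*) [Ring R] (a : R) : Prop :=
  rFix R 1 ≤ rFix R a ∧ rFix R a ≤ rFix R 1

/-- Let `a, e ∈ R` with `e` idempotent and `a*e = 0`. Set
`b := e + (1-e)*a` and `c := (1-e) + e*a`. Then `a = b*c`, `c` is idempotent,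
`eR = rann(c)`, `eR ⊆ rfix(b)`, `rfix(a) ⊆ rfix(b)`, `rfix(a) ⊆ rfix(c)`, and
`rann(a) ∩ (1-e)R` is contained in both `rann(b)` and `rfix(c)`. -/
theorem factorization_through_idempotent
    {R : Type*} [Ring R] [Nontrivial R] (a e : R) (he : e * e = e) (hae : a * e = 0) :
    a = (e + (1 - e) * a) * ((1 - e) + e * a) ∧
    ((1 - e) + e * a) * ((1 - e) + e * a) = (1 - e) + e * a ∧
    rPrin R e = rAnn R ((1 - e) + e * a) ∧
    rPrin R e ≤ rFix R (e + (1 - e) * a) ∧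
    rFix R a ≤ rFix R (e + (1 - e) * a) ∧
    rFix R a ≤ rFix R ((1 - e) + e * a) ∧
    rAnn R a ⊓ rPrin R (1 - e) ≤ rAnn R (e + (1 - e) * a) ∧
    rAnn R a ⊓ rPrin R (1 - e) ≤ rFix R ((1 - e) + e * a) := by
  have he_mul (x : R) : e * (e * x) = e * x := by rw [← mul_assoc, he]
  have hae_mul (x : R) : a * (e * x) = 0 := by rw [← mul_assoc, hae, zero_mul]
  refine ⟨?_, ?_, le_antisymm ?_ ?_, ?_, ?_, ?_, ?_, ?_⟩
  · simp [mul_add, add_mul, mul_sub, sub_mul, mul_assoc, he, hae, he_mul, hae_mul]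
  · simp [mul_add, add_mul, mul_sub, sub_mul, mul_assoc, he, hae, he_mul, hae_mul]
  · rintro _ ⟨y, rfl⟩
    change (1 - e + e * a) * (e * y) = 0
    simp [add_mul, sub_mul, mul_assoc, he_mul, hae_mul]
  · intro x (hx : (1 - e + e * a) * x = 0)
    have h : (1 - e) * ((1 - e + e * a) * x) = x - e * x := by
      simp [mul_add, add_mul, mul_sub, sub_mul, mul_assoc, he_mul]
    rw [hx, mul_zero] at h
    exact ⟨x, sub_eq_zero.mp h.symm⟩
  · rintro _ ⟨y, rfl⟩
    change (e + (1 - e) * a) * (e * y) = e * y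
    simp [add_mul, mul_assoc, he_mul, hae_mul]
  · intro x (hx : a * x = x)
    change (e + (1 - e) * a) * x = x
    simp [add_mul, sub_mul, mul_assoc, hx]
  · intro x (hx : a * x = x)
    change (1 - e + e * a) * x = x
    simp [add_mul, sub_mul, mul_assoc, hx]
  · rintro x ⟨hx : a * x = 0, y, hy⟩
    have hex : e * x = 0 := by simp [hy, mul_sub, sub_mul, he_mul]
    change (e + (1 - e) * a) * x = 0
    simp [add_mul, mul_assoc, hx, hex]
  · rintro x ⟨hx : a * x = 0, y, hy⟩
    have hex : e * x = 0 := by simp [hy, mul_sub, sub_mul, he_mul]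
    change (1 - e + e * a) * x = x
    simp [add_mul, sub_mul, mul_assoc, hx, hex]
end

section
/- Let R be an associative unital nonzero ring, H the monoid consisting of the left zero divisors of R together with 1, equipped with the rFix-preorder, and let a ∈ R be such that rann(a) is a direct summand of R as a right R-module. If a is an rFix-irreducible (of degree 2) of H, then rann(a) is an indecomposable submodule of the right R-module R, rann(a) = rann(a²), and rann(a) ∩ aR = {0}. -/
theorem mem_rAnn {R : Type*} [Ring R] {a x : R} : x ∈ rAnn R a ↔ a * x = 0 := Iff.rfl

theorem mem_rFix {R : Type*} [Ring R] {a x : R} : x ∈ rFix R a ↔ a * x = x := Iff.rfl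

theorem Submodule.mul_mem_of_mem_mulOpposite {R : Type*} [Ring R] (N : Submodule Rᵐᵒᵖ R)
    {x : R} (hx : x ∈ N) (r : R) : x * r ∈ N :=
  N.smul_mem (MulOpposite.op r) hx

theorem isRFixUnit_iff {R : Type*} [Ring R] {a : R} : IsRFixUnit R a ↔ a = 1 := by
  constructor
  · rintro ⟨h, -⟩
    simpa [mem_rFix] using h (show (1 : R) ∈ rFix R 1 from one_mul 1)
  · rintro rfl
    exact ⟨le_rfl, le_rfl⟩

theorem not_isRFixUnit_of_mul_eq_zero {R : Type*} [Ring R] {a x : R} (hx : x ≠ 0)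
    (h : a * x = 0) : ¬ IsRFixUnit R a := by
  rw [isRFixUnit_iff]
  rintro rfl
  exact hx (by simpa using h)

/-- An idempotent `e` in `rann(a)` killing `rfix(a)` gives the factorization
`a = (a + e) * (1 - e)`; it is proper as soon as `a + e` is a left zero divisor and
`rann(e)` is not contained in `rfix(a)`. -/
theorem exists_rFix_factorization {R : Type*} [Ring R] {a e z w : R}
    (hae : a * e = 0) (hee : e * e = e) (he : e ≠ 0)
    (hfix : ∀ x, a * x = x → e * x = 0)
    (hz : z ≠ 0) (hbz : (a + e) * z = 0) (hew : e * w = 0) (haw : a * w ≠ w) :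
    ∃ b c : R, IsLeftZDOrOne R b ∧ IsLeftZDOrOne R c ∧
      ¬ IsRFixUnit R b ∧ ¬ IsRFixUnit R c ∧
      rFix R a < rFix R b ∧ rFix R a < rFix R c ∧ a = b * c := by
  have hce : (1 - e) * e = 0 := by rw [sub_mul, one_mul, hee, sub_self]
  refine ⟨a + e, 1 - e, Or.inl ⟨z, hz, hbz⟩, Or.inl ⟨e, he, hce⟩,
    not_isRFixUnit_of_mul_eq_zero hz hbz, not_isRFixUnit_of_mul_eq_zero he hce, ?_, ?_, ?_⟩
  · refine SetLike.lt_iff_le_and_exists.2 ⟨fun x hx => ?_, e, ?_, fun h => ?_⟩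
    · rw [mem_rFix] at hx ⊢
      rw [add_mul, hx, hfix x hx, add_zero]
    · rw [mem_rFix, add_mul, hae, hee, zero_add]
    · rw [mem_rFix, hae] at h
      exact he h.symm
  · refine SetLike.lt_iff_le_and_exists.2 ⟨fun x hx => ?_, w, ?_, haw⟩
    · rw [mem_rFix] at hx ⊢
      rw [sub_mul, hfix x hx, one_mul, sub_zero]
    · rw [mem_rFix, sub_mul, hew, one_mul, sub_zero]
  · rw [mul_sub, add_mul a e e, hae, hee, mul_one]
    abel

/-- If `p + q` acts as a left identity on `N₁ ⊔ N₂`, where `p ∈ N₁`, `q ∈ N₂` and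
`N₁ ⊓ N₂ = ⊥`, then `p` acts as the identity on `N₁` and as zero on `N₂`. -/
theorem mul_eq_of_inf_eq_bot {R : Type*} [Ring R] {N₁ N₂ : Submodule Rᵐᵒᵖ R}
    (hinf : N₁ ⊓ N₂ = ⊥) {p q : R} (hp : p ∈ N₁) (hq : q ∈ N₂)
    (hid : ∀ x ∈ N₁ ⊔ N₂, (p + q) * x = x) :
    (∀ x ∈ N₁, p * x = x) ∧ ∀ x ∈ N₂, p * x = 0 := by
  have hbot : ∀ x, x ∈ N₁ → x ∈ N₂ → x = 0 := fun x h₁ h₂ =>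
    (Submodule.mem_bot Rᵐᵒᵖ).1 (hinf ▸ Submodule.mem_inf.2 ⟨h₁, h₂⟩)
  constructor
  · intro x hx
    have hpq : x - p * x = q * x := by
      rw [sub_eq_iff_eq_add', ← add_mul, hid x (Submodule.mem_sup_left hx)]
    refine (sub_eq_zero.1 (hbot _ (N₁.sub_mem hx (N₁.mul_mem_of_mem_mulOpposite hp x)) ?_)).symm
    rw [hpq]
    exact N₂.mul_mem_of_mem_mulOpposite hq x
  · intro x hx
    have hpq : p * x = x - q * x := by
      rw [eq_sub_iff_add_eq, ← add_mul, hid x (Submodule.mem_sup_right hx)]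
    refine hbot _ (N₁.mul_mem_of_mem_mulOpposite hp x) ?_
    rw [hpq]
    exact N₂.sub_mem hx (N₂.mul_mem_of_mem_mulOpposite hq x)

/-- Let `H` be the monoid of left zero divisors of `R` together with
`1`, with the rFix-preorder (`x ⪯ y` iff `rfix(y) ⊆ rfix(x)`), and let `a ∈ H` be such
that `rann(a)` is a direct summand of `R_R`. If `a` is an rFix-irreducible of degree 2
of `H` (a `⪯`-non-unit which is not a product of two `⪯`-non-units of `H` strictly
smaller than `a`), then `rann(a)` is an indecomposable submodule of `R_R`,
`rann(a) = rann(a²)`, and `rann(a) ∩ aR = {0}`. -/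
theorem rFix_irreducible_rann_indecomposable
    {R : Type*} [Ring R] [Nontrivial R] (a : R)
    (haH : IsLeftZDOrOne R a)
    (hds : ∃ J : Submodule Rᵐᵒᵖ R, rAnn R a ⊓ J = ⊥ ∧ rAnn R a ⊔ J = ⊤)
    (hnu : ¬ IsRFixUnit R a)
    (hirr : ¬ ∃ b c : R, IsLeftZDOrOne R b ∧ IsLeftZDOrOne R c ∧
      ¬ IsRFixUnit R b ∧ ¬ IsRFixUnit R c ∧
      rFix R a < rFix R b ∧ rFix R a < rFix R c ∧ a = b * c) :
    IndecRId (rAnn R a) ∧ rAnn R a = rAnn R (a * a) ∧ rAnn R a ⊓ rPrin R a = ⊥ := by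
  have ha : ∃ y : R, y ≠ 0 ∧ a * y = 0 :=
    haH.resolve_right fun h => hnu (isRFixUnit_iff.2 h)
  obtain ⟨y₀, hy₀, hay₀⟩ := ha
  obtain ⟨J, hinf, hsup⟩ := hds
  obtain ⟨k, hk, j, hj, hkj⟩ :=
    Submodule.mem_sup.1 (hsup ▸ Submodule.mem_top : (1 : R) ∈ rAnn R a ⊔ J)
  have hkid : ∀ x, a * x = 0 → k * x = x :=
    (mul_eq_of_inf_eq_bot hinf hk hj fun x _ => by rw [hkj, one_mul]).1
  rw [mem_rAnn] at hk
  have hdisj : rAnn R a ⊓ rPrin R a = ⊥ := by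
    rw [eq_bot_iff]
    rintro y ⟨hay, x, hx⟩
    replace hay : a * y = 0 := hay
    rw [Submodule.mem_bot]
    by_contra hy
    have hae : a * (k * (1 - a)) = 0 := by rw [← mul_assoc, hk, zero_mul]
    have heid : ∀ u, a * u = 0 → k * (1 - a) * u = u := fun u hu => by
      rw [mul_assoc, sub_mul, hu, one_mul, sub_zero, hkid u hu]
    have hfix : ∀ u, a * u = u → k * (1 - a) * u = 0 := fun u hu => by
      rw [mul_assoc, sub_mul, hu, one_mul, sub_self, mul_zero]
    generalize k * (1 - a) = e at hae heid hfix
    have hee : e * e = e := heid e hae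
    have hey : e * y = y := heid y hay
    have haw : a * (x - e * x) = y := by
      rw [mul_sub, ← mul_assoc, hae, zero_mul, sub_zero, hx]
    have hew : e * (x - e * x) = 0 := by rw [mul_sub, ← mul_assoc, hee, sub_self]
    refine hirr (exists_rFix_factorization (z := x - e * x - y) (w := x - e * x)
      hae hee ?_ hfix ?_ ?_ hew ?_)
    · rintro rfl
      exact hy (by simpa using hey.symm)
    · intro h
      rw [sub_eq_zero.1 h, hay] at haw
      exact hy haw.symm
    · rw [mul_sub, add_mul, add_mul, haw, hew, hay, hey]
      abel
    · intro h
      rw [← h, haw, hey] at hew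
      exact hy hew
  refine ⟨⟨fun h => hy₀ ?_, ?_⟩, ?_, hdisj⟩
  · exact (Submodule.mem_bot Rᵐᵒᵖ).1 (h ▸ mem_rAnn.2 hay₀)
  · rintro ⟨N₁, N₂, hN₁, hN₂, hN, hsum⟩
    have hann₁ : ∀ x ∈ N₁, a * x = 0 := fun x hx =>
      mem_rAnn.1 (hsum ▸ Submodule.mem_sup_left hx)
    have hann₂ : ∀ x ∈ N₂, a * x = 0 := fun x hx =>
      mem_rAnn.1 (hsum ▸ Submodule.mem_sup_right hx)
    obtain ⟨p, hp, q, hq, rfl⟩ := Submodule.mem_sup.1 (hsum ▸ mem_rAnn.2 hk : k ∈ N₁ ⊔ N₂)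
    obtain ⟨hp₁, hp₂⟩ := mul_eq_of_inf_eq_bot hN hp hq
      fun x hx => hkid x (mem_rAnn.1 (hsum ▸ hx))
    obtain ⟨u, hu, hu0⟩ := Submodule.exists_mem_ne_zero_of_ne_bot hN₁
    obtain ⟨v, hv, hv0⟩ := Submodule.exists_mem_ne_zero_of_ne_bot hN₂
    have heu : p * (1 - a) * u = u := by
      rw [mul_assoc, sub_mul, hann₁ u hu, one_mul, sub_zero, hp₁ u hu]
    have hev : p * (1 - a) * v = 0 := by
      rw [mul_assoc, sub_mul, hann₂ v hv, one_mul, sub_zero, hp₂ v hv]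
    have hap := hann₁ p hp
    refine hirr (exists_rFix_factorization (e := p * (1 - a)) (z := v) (w := v)
      ?_ ?_ ?_ ?_ hv0 ?_ hev ?_)
    · rw [← mul_assoc, hap, zero_mul]
    · have h : p * (1 - a) * p = p := by
        rw [mul_assoc, sub_mul, hap, one_mul, sub_zero, hp₁ p hp]
      rw [← mul_assoc, h]
    · intro h
      rw [h, zero_mul] at heu
      exact hu0 heu.symm
    · intro x hx
      rw [mul_assoc, sub_mul, hx, one_mul, sub_self, mul_zero]
    · rw [add_mul, hann₂ v hv, hev, add_zero]
    · rw [hann₂ v hv]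
      exact hv0.symm
  · ext x
    rw [mem_rAnn, mem_rAnn, mul_assoc]
    refine ⟨fun h => by rw [h, mul_zero], fun h => ?_⟩
    exact (Submodule.mem_bot Rᵐᵒᵖ).1 (hdisj ▸ Submodule.mem_inf.2 ⟨mem_rAnn.2 h, x, rfl⟩)
end

section
/- Let R be an associative unital nonzero ring, H the monoid consisting of the left zero divisors of R together with 1, equipped with the rFix-preorder, and let a ∈ R be such that rann(a) is a direct summand of R as a right R-module. If a is an rFix-quark of H, then a is a coprimitive idempotent of R. -/
theorem isRFixUnit_iff_eq_one {R : Type*} [Ring R] (a : R) : IsRFixUnit R a ↔ a = 1 := by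
  constructor
  · intro h
    have h1 : (1 : R) ∈ rFix R a := h.1 (one_mul 1)
    have h2 : a * 1 = 1 := h1
    rwa [mul_one] at h2
  · rintro rfl
    exact ⟨le_rfl, le_rfl⟩

/-- If `rann(a)` is a direct summand, it contains a left identity for itself. -/
theorem exists_left_identity_rAnn {R : Type*} [Ring R] (a : R)
    (hds : ∃ J : Submodule Rᵐᵒᵖ R, rAnn R a ⊓ J = ⊥ ∧ rAnn R a ⊔ J = ⊤) :
    ∃ f : R, a * f = 0 ∧ ∀ x, a * x = 0 → f * x = x := by
  obtain ⟨J, hinf, hsup⟩ := hds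
  have h1 : (1 : R) ∈ rAnn R a ⊔ J := hsup ▸ Submodule.mem_top
  obtain ⟨f, hf, e, he, hfe⟩ := Submodule.mem_sup.mp h1
  refine ⟨f, hf, fun x hx => ?_⟩
  have hfx : f * x ∈ rAnn R a := (rAnn R a).smul_mem (MulOpposite.op x) hf
  have hex : e * x ∈ J := J.smul_mem (MulOpposite.op x) he
  have hsum : f * x + e * x = x := by rw [← add_mul, hfe, one_mul]
  have hex' : e * x ∈ rAnn R a := by
    rw [← eq_sub_iff_add_eq'] at hsum
    rw [hsum]
    exact (rAnn R a).sub_mem hx hfx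
  have h0 : e * x = 0 := by
    have : e * x ∈ rAnn R a ⊓ J := ⟨hex', hex⟩
    rwa [hinf, Submodule.mem_bot] at this
  rwa [h0, add_zero] at hsum

/-- An element `b` with a nonzero right annihilator cannot have strictly more fixed points than
a quark `a`. -/
theorem rFix_le_of_quark {R : Type*} [Ring R] {a b y : R}
    (hquark : ¬ ∃ b : R, IsLeftZDOrOne R b ∧ ¬ IsRFixUnit R b ∧ rFix R a < rFix R b)
    (hy : y ≠ 0) (hby : b * y = 0) (hab : rFix R a ≤ rFix R b) : rFix R b ≤ rFix R a := by
  by_contra hba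
  refine hquark ⟨b, Or.inl ⟨y, hy, hby⟩, ?_, lt_of_le_not_ge hab hba⟩
  rw [isRFixUnit_iff_eq_one]
  rintro rfl
  exact hy (by simpa using hby)

theorem isIdempotentElem_of_quark {R : Type*} [Ring R] {a y : R} (hy : y ≠ 0) (hay : a * y = 0)
    (hds : ∃ J : Submodule Rᵐᵒᵖ R, rAnn R a ⊓ J = ⊥ ∧ rAnn R a ⊔ J = ⊤)
    (hquark : ¬ ∃ b : R, IsLeftZDOrOne R b ∧ ¬ IsRFixUnit R b ∧ rFix R a < rFix R b) :
    a * a = a := by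
  obtain ⟨f, haf, hf⟩ := exists_left_identity_rAnn a hds
  have hff : f * f = f := hf f haf
  have hby : (1 - f + f * a) * y = 0 := by
    rw [add_mul, sub_mul, one_mul, hf y hay, mul_assoc, hay, mul_zero, sub_self, add_zero]
  have hab : rFix R a ≤ rFix R (1 - f + f * a) := by
    intro x (hx : a * x = x)
    show (1 - f + f * a) * x = x
    rw [add_mul, sub_mul, one_mul, mul_assoc, hx, sub_add_cancel]
  have hba := rFix_le_of_quark hquark hy hby hab
  have hbb : (1 - f + f * a) * (1 - f + f * a) = 1 - f + f * a := by
    have h1 : f * a * f = 0 := by rw [mul_assoc, haf, mul_zero]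
    have h2 : f * a * (f * a) = 0 := by rw [← mul_assoc, h1, zero_mul]
    have h3 : f * (f * a) = f * a := by rw [← mul_assoc, hff]
    simp only [mul_add, add_mul, mul_sub, sub_mul, one_mul, mul_one, hff, h1, h2, h3]
    abel
  have hbfix : a * (1 - f + f * a) = 1 - f + f * a := hba hbb
  have hb : a * (1 - f + f * a) = a := by
    rw [mul_add, mul_sub, mul_one, haf, ← mul_assoc, haf, zero_mul, sub_zero, add_zero]
  have hbeq : 1 - f + f * a = a := hbfix.symm.trans hb
  rwa [hbeq] at hbfix

theorem indecRId_rAnn_of_quark {R : Type*} [Ring R] {a y : R} (hy : y ≠ 0) (hay : a * y = 0)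
    (haa : a * a = a)
    (hquark : ¬ ∃ b : R, IsLeftZDOrOne R b ∧ ¬ IsRFixUnit R b ∧ rFix R a < rFix R b) :
    IndecRId (rAnn R a) := by
  refine ⟨fun h => hy ?_, ?_⟩
  · have : y ∈ rAnn R a := hay
    rwa [h, Submodule.mem_bot] at this
  rintro ⟨N₁, N₂, hN₁, hN₂, hinf, hsup⟩
  have hg : 1 - a ∈ N₁ ⊔ N₂ := by
    rw [hsup]
    show a * (1 - a) = 0
    rw [mul_sub, mul_one, haa, sub_self]
  obtain ⟨g₁, hg₁, g₂, hg₂, hgg⟩ := Submodule.mem_sup.mp hg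
  have unique : ∀ {u v u' v' : R}, u ∈ N₁ → v ∈ N₂ → u' ∈ N₁ → v' ∈ N₂ →
      u + v = u' + v' → v = v' := by
    intro u v u' v' hu hv hu' hv' h
    have h1 : v - v' = u' - u := by
      rw [sub_eq_sub_iff_add_eq_add, add_comm v, h]
    have h2 : v - v' ∈ N₁ ⊓ N₂ :=
      ⟨by rw [h1]; exact N₁.sub_mem hu' hu, N₂.sub_mem hv hv'⟩
    rw [hinf, Submodule.mem_bot] at h2
    exact sub_eq_zero.mp h2
  have hm₁ : ∀ x, g₁ * x ∈ N₁ := fun x => N₁.smul_mem (MulOpposite.op x) hg₁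
  have hm₂ : ∀ x, g₂ * x ∈ N₂ := fun x => N₂.smul_mem (MulOpposite.op x) hg₂
  have hsplit : ∀ x, g₁ * x + g₂ * x = x - a * x := fun x => by
    rw [← add_mul, hgg, sub_mul, one_mul]
  have hz₁ : ∀ x ∈ N₁, a * x = 0 := fun x hx =>
    (hsup ▸ Submodule.mem_sup_left hx : x ∈ rAnn R a)
  have hz₂ : ∀ x ∈ N₂, a * x = 0 := fun x hx =>
    (hsup ▸ Submodule.mem_sup_right hx : x ∈ rAnn R a)
  have hk₁ : ∀ x ∈ N₁, g₂ * x = 0 := fun x hx =>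
    unique (hm₁ x) (hm₂ x) hx N₂.zero_mem (by rw [hsplit, hz₁ x hx, sub_zero, add_zero])
  have hk₂ : ∀ x ∈ N₂, g₂ * x = x := fun x hx =>
    unique (hm₁ x) (hm₂ x) N₁.zero_mem hx (by rw [hsplit, hz₂ x hx, sub_zero, zero_add])
  obtain ⟨z, hz, hz0⟩ := Submodule.exists_mem_ne_zero_of_ne_bot hN₂
  obtain ⟨w, hw, hw0⟩ := Submodule.exists_mem_ne_zero_of_ne_bot hN₁
  have hba := rFix_le_of_quark (b := 1 - g₂) hquark hz0
    (by rw [sub_mul, one_mul, hk₂ z hz, sub_self]) (by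
      intro x (hx : a * x = x)
      show (1 - g₂) * x = x
      have : g₂ * x = 0 :=
        unique (hm₁ x) (hm₂ x) N₁.zero_mem N₂.zero_mem (by rw [hsplit, hx, sub_self, add_zero])
      rw [sub_mul, one_mul, this, sub_zero])
  have hwb : (1 - g₂) * w = w := by rw [sub_mul, one_mul, hk₁ w hw, sub_zero]
  have hwa : a * w = w := hba hwb
  exact hw0 (hwa.symm.trans (hz₁ w hw))

/-- Let `H` be the monoid of left zero divisors of `R` together with
`1`, with the rFix-preorder, and let `a ∈ H` be such that `rann(a)` is a direct summand
of `R_R`. If `a` is an rFix-quark of `H` (a `⪯`-non-unit with no `⪯`-non-unit of `H`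
strictly below it), then `a` is a coprimitive idempotent of `R`. -/
theorem rFix_quark_is_coprimitive_idempotent
    {R : Type*} [Ring R] [Nontrivial R] (a : R)
    (haH : IsLeftZDOrOne R a)
    (hds : ∃ J : Submodule Rᵐᵒᵖ R, rAnn R a ⊓ J = ⊥ ∧ rAnn R a ⊔ J = ⊤)
    (hnu : ¬ IsRFixUnit R a)
    (hquark : ¬ ∃ b : R, IsLeftZDOrOne R b ∧ ¬ IsRFixUnit R b ∧ rFix R a < rFix R b) :
    a * a = a ∧ IndecRId (rAnn R a) := by
  obtain ⟨y, hy, hay⟩ := haH.resolve_right (mt (isRFixUnit_iff_eq_one a).mpr hnu)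
  have haa := isIdempotentElem_of_quark hy hay hds hquark
  exact ⟨haa, indecRId_rAnn_of_quark hy hay haa hquark⟩
end

section
/- Let R be a right Rickart ring whose right uniform dimension udim(R_R) is finite. Then for every a ∈ R, the rFix-height of a relative to the multiplicative monoid of R is finite and bounded above by udim(R_R) − rdim(rfix(a)), where rdim(rfix(a)) is the uniform dimension of the right ideal rfix(a) viewed as a submodule of R_R. In particular, every multiplicative submonoid of R is strongly rFix-artinian. -/
/-- The uniform dimension of a right ideal `I` of `R`: the supremum in `ℕ∞`
(with `sSup ∅ = 0`) of the set of integers `k ≥ 1` such that `I` contains an internal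
direct sum of `k` nonzero right ideals. -/
noncomputable def rUdim (R : Type*) [Ring R] (I : Submodule Rᵐᵒᵖ R) : ℕ∞ :=
  sSup ((fun k : ℕ => (k : ℕ∞)) ''
    {k : ℕ | 1 ≤ k ∧ ∃ N : Fin k → Submodule Rᵐᵒᵖ R,
      (∀ i, N i ≠ ⊥) ∧ iSupIndep N ∧ ∀ i, N i ≤ I})

/-- The rFix-height of `x` relative to a subset `S` of the ring `R` (for `S` a
multiplicative submonoid, this is the height with respect to the restriction to `S` of
the rFix-preorder): the supremum in `ℕ∞` (with `sSup ∅ = 0`) of the set of integers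
`n ≥ 1` for which there exist `⪯`-non-units `x₁, …, xₙ ∈ S` with `x₁ = x` and
`x_{k+1} ≺ x_k` (i.e. `rfix(x_k) ⊊ rfix(x_{k+1})`) for `1 ≤ k ≤ n-1`. -/
noncomputable def rFixHgtIn (R : Type*) [Ring R] (S : Set R) (x : R) : ℕ∞ :=
  sSup ((fun n : ℕ => (n : ℕ∞)) ''
    {n : ℕ | 1 ≤ n ∧ ∃ f : ℕ → R, f 1 = x ∧
      (∀ i, 1 ≤ i → i ≤ n → f i ∈ S ∧ ¬ IsRFixUnit R (f i)) ∧
      (∀ i, 1 ≤ i → i < n → rFix R (f i) < rFix R (f (i + 1)))})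

/-- Prepending an element disjoint from an upper bound of an independent family keeps it
independent. -/
theorem iSupIndep.fin_cons {α : Type*} [CompleteLattice α] [IsModularLattice α] {k : ℕ}
    {N : Fin k → α} {I M : α} (hN : iSupIndep N) (hle : ∀ i, N i ≤ I) (hM : Disjoint I M) :
    iSupIndep (Fin.cons M N : Fin (k + 1) → α) := by
  intro i
  refine Fin.cases ?_ (fun i => ?_) i
  · refine hM.symm.mono_right (iSup₂_le fun j => ?_)
    refine Fin.cases (fun h => absurd rfl h) (fun j _ => ?_) j
    simpa using hle j
  · rw [Fin.cons_succ]
    have hA : Disjoint (N i ⊔ ⨆ (j) (_ : j ≠ i), N j) M :=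
      hM.mono_left (sup_le (hle i) (iSup₂_le fun j _ => hle j))
    refine ((hN i).disjoint_sup_right_of_disjoint_sup_left hA).mono_right (iSup₂_le fun j => ?_)
    refine Fin.cases (fun _ => ?_) (fun j h => ?_) j
    · exact le_sup_right
    · rw [Fin.cons_succ]
      exact le_sup_of_le_left (le_iSup₂_of_le j (fun e => h (congrArg Fin.succ e)) le_rfl)

/-- `I` contains an internal direct sum of `k` nonzero right ideals. -/
def HasIndepFamily {R : Type*} [Ring R] (I : Submodule Rᵐᵒᵖ R) (k : ℕ) : Prop :=
  ∃ N : Fin k → Submodule Rᵐᵒᵖ R, (∀ i, N i ≠ ⊥) ∧ iSupIndep N ∧ ∀ i, N i ≤ I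

theorem HasIndepFamily.zero {R : Type*} [Ring R] (I : Submodule Rᵐᵒᵖ R) : HasIndepFamily I 0 :=
  ⟨Fin.elim0, fun i => i.elim0, fun i => i.elim0, fun i => i.elim0⟩

theorem HasIndepFamily.le_rUdim {R : Type*} [Ring R] {I : Submodule Rᵐᵒᵖ R} {k : ℕ}
    (h : HasIndepFamily I k) : (k : ℕ∞) ≤ rUdim R I := by
  rcases Nat.eq_zero_or_pos k with rfl | hk
  · simp
  · exact le_sSup ⟨k, ⟨hk, h⟩, rfl⟩

/-- Enlarging a direct summand strictly leaves room for one more nonzero right ideal. -/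
theorem HasIndepFamily.succ_of_lt {R : Type*} [Ring R] {I J K : Submodule Rᵐᵒᵖ R} {k : ℕ}
    (h : HasIndepFamily I k) (hJ : IsCompl I J) (hK : I < K) : HasIndepFamily K (k + 1) := by
  obtain ⟨N, hne, hind, hle⟩ := h
  have hM : J ⊓ K ≠ ⊥ := fun hbot => hK.ne <| by
    rw [← sup_bot_eq I, ← hbot, ← sup_inf_assoc_of_le J hK.le, hJ.sup_eq_top, top_inf_eq]
  refine ⟨Fin.cons (J ⊓ K) N, Fin.cases hM hne,
    hind.fin_cons hle (hJ.disjoint.mono_right inf_le_left), Fin.cases inf_le_right fun i => ?_⟩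
  exact (hle i).trans hK.le

theorem rFix_eq_rAnn {R : Type*} [Ring R] (a : R) : rFix R a = rAnn R (1 - a) := by
  ext x
  change a * x = x ↔ (1 - a) * x = 0
  rw [sub_mul, one_mul, sub_eq_zero, eq_comm]

theorem rFix_lt_top {R : Type*} [Ring R] {a : R} (ha : ¬ IsRFixUnit R a) : rFix R a < ⊤ := by
  have h1 : rFix R 1 = ⊤ := eq_top_iff.2 fun x _ => one_mul x
  refine lt_top_iff_ne_top.2 fun h => ha ?_
  rw [IsRFixUnit, h, h1]
  exact ⟨le_rfl, le_rfl⟩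

/-- A strictly `⪯`-descending chain of `n` non-units adds `n` summands to those in `rfix(f 1)`. -/
theorem HasIndepFamily.top_of_chain {R : Type*} [Ring R]
    (hcompl : ∀ a : R, ∃ J, IsCompl (rFix R a) J) {f : ℕ → R} {n k : ℕ} (hn : 1 ≤ n)
    (hunit : ∀ i, 1 ≤ i → i ≤ n → ¬ IsRFixUnit R (f i))
    (hlt : ∀ i, 1 ≤ i → i < n → rFix R (f i) < rFix R (f (i + 1)))
    (h : HasIndepFamily (rFix R (f 1)) k) : HasIndepFamily (⊤ : Submodule Rᵐᵒᵖ R) (k + n) := by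
  have key : ∀ m, m < n → HasIndepFamily (rFix R (f (m + 1))) (k + m) := by
    intro m
    induction m with
    | zero => exact fun _ => h
    | succ m ih =>
      intro hm
      obtain ⟨J, hJ⟩ := hcompl (f (m + 1))
      exact (ih (by omega)).succ_of_lt hJ (hlt (m + 1) (by omega) hm)
  obtain ⟨m, rfl⟩ := Nat.exists_eq_add_of_le' hn
  obtain ⟨J, hJ⟩ := hcompl (f (m + 1))
  exact (key m (by omega)).succ_of_lt hJ (rFix_lt_top (hunit (m + 1) hn le_rfl))

theorem rUdim_mono {R : Type*} [Ring R] {I K : Submodule Rᵐᵒᵖ R} (h : I ≤ K) :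
    rUdim R I ≤ rUdim R K := by
  refine sSup_le ?_
  rintro _ ⟨k, ⟨_, N, hne, hind, hle⟩, rfl⟩
  exact HasIndepFamily.le_rUdim ⟨N, hne, hind, fun i => (hle i).trans h⟩

theorem rFixHgtIn_le {R : Type*} [Ring R] (hcompl : ∀ a : R, ∃ J, IsCompl (rFix R a) J)
    (hfin : rUdim R ⊤ ≠ ⊤) (S : Set R) (a : R) :
    rFixHgtIn R S a ≤ rUdim R ⊤ - rUdim R (rFix R a) := by
  refine sSup_le ?_
  rintro _ ⟨n, ⟨hn, f, rfl, hS, hlt⟩, rfl⟩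
  have hadd {k : ℕ} (hk : HasIndepFamily (rFix R (f 1)) k) : (k : ℕ∞) + n ≤ rUdim R ⊤ := by
    have := (hk.top_of_chain hcompl hn (fun i h1 h2 => (hS i h1 h2).2) hlt).le_rUdim
    exact_mod_cast this
  have hn' : (n : ℕ∞) ≤ rUdim R ⊤ := le_add_self.trans (hadd (HasIndepFamily.zero _))
  refine ENat.le_sub_of_add_le_left (ne_top_of_le_ne_top hfin (rUdim_mono le_top)) ?_
  refine add_le_of_le_tsub_right_of_le hn' (sSup_le ?_)
  rintro _ ⟨k, ⟨_, hk⟩, rfl⟩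
  exact ENat.le_sub_of_add_le_right (ENat.natCast_ne_top n) (hadd hk)

/-- Let `R` be a right Rickart ring of finite right uniform
dimension. Then the rFix-height of every `a ∈ R` (relative to the multiplicative monoid
of `R`) is finite and bounded above by `udim(R_R) - rdim(rfix(a))`; in particular,
every multiplicative submonoid of `R` is strongly rFix-artinian. -/
theorem rickart_strongly_rFix_artinian
    {R : Type*} [Ring R] [Nontrivial R]
    (hrick : ∀ x : R, ∃ J : Submodule Rᵐᵒᵖ R, rAnn R x ⊓ J = ⊥ ∧ rAnn R x ⊔ J = ⊤)
    (hfin : rUdim R ⊤ ≠ ⊤) :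
    (∀ a : R, rFixHgtIn R Set.univ a ≠ ⊤ ∧
      rFixHgtIn R Set.univ a ≤ rUdim R ⊤ - rUdim R (rFix R a)) ∧
    ∀ S : Submonoid R, ∀ x ∈ S, rFixHgtIn R (S : Set R) x ≠ ⊤ := by
  have hcompl : ∀ a : R, ∃ J, IsCompl (rFix R a) J := fun a => by
    obtain ⟨J, h1, h2⟩ := hrick (1 - a)
    exact ⟨J, rFix_eq_rAnn a ▸ IsCompl.of_eq h1 h2⟩
  have hne (S : Set R) (a : R) : rFixHgtIn R S a ≠ ⊤ :=
    ne_top_of_le_ne_top hfin ((rFixHgtIn_le hcompl hfin S a).trans tsub_le_self)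
  exact ⟨fun a => ⟨hne _ a, rFixHgtIn_le hcompl hfin _ a⟩, fun S x _ => hne _ x⟩
end

section
/- Let R be a Dedekind-finite, von Neumann regular ring satisfying the comparability axiom, and let R^# be the monoid of zero divisors of R (the elements that are both left and right zero divisors, together with 1), equipped with the rFix-preorder. If a ∈ R^# is an rFix-irreducible (of degree 2) of R^#, then a is a coprimitive idempotent of R. -/
/-- Membership in the monoid `R^#` of zero divisors of `R` (elements that are both
left and right zero divisors) together with `1`. -/
def IsZDOrOne (R : Type*) [Ring R] (a : R) : Prop :=
  ((∃ y : R, y ≠ 0 ∧ a * y = 0) ∧ (∃ y : R, y ≠ 0 ∧ y * a = 0)) ∨ a = 1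

theorem rFix_lt {R : Type*} [Ring R] {a b w : R} (h : ∀ x, a * x = x → b * x = x)
    (hw : b * w = w) (hw' : a * w ≠ w) : rFix R a < rFix R b :=
  lt_of_le_of_ne (fun x hx => h x hx) fun he => hw' (mem_rFix.1 (he ▸ mem_rFix.2 hw))

/-- In a Dedekind-finite regular ring, right zero divisors are left zero divisors. -/
theorem isZDOrOne_of_mul_eq_zero {R : Type*} [Ring R]
    (hdf : ∀ x y : R, x * y = 1 → y * x = 1) (hvnr : ∀ x : R, ∃ y : R, x = x * y * x)
    {b y : R} (hy : y ≠ 0) (hyb : y * b = 0) : IsZDOrOne R b := by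
  refine Or.inl ⟨?_, y, hy, hyb⟩
  by_contra! hb
  obtain ⟨b', hb'⟩ := hvnr b
  have h1 : b' * b = 1 := by
    by_contra hne
    exact hb (1 - b' * b) (sub_ne_zero.2 (Ne.symm hne)) (by
      rw [mul_sub, mul_one, ← mul_assoc, ← hb', sub_self])
  apply hy
  rw [← mul_one y, ← hdf _ _ h1, ← mul_assoc, hyb, zero_mul]

/-- An embedding `uR → vR` with `u ≠ 0` yields a nonzero element of `vRu`. -/
theorem exists_mul_mul_ne_zero_of_injective {R : Type*} [Ring R]
    (hvnr : ∀ x : R, ∃ y : R, x = x * y * x) {u v : R} (hu : u ≠ 0)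
    (φ : rPrin R u →ₗ[Rᵐᵒᵖ] rPrin R v) (hφ : Function.Injective φ) :
    ∃ y, v * y * u ≠ 0 := by
  obtain ⟨u', hu'⟩ := hvnr u
  let p : rPrin R u := ⟨u, 1, (mul_one u).symm⟩
  obtain ⟨r, hr⟩ := (φ p).2
  have hp : p = MulOpposite.op (u' * u) • p := by
    apply Subtype.ext
    change u = u * (u' * u)
    rw [← mul_assoc]
    exact hu'
  have h : ((φ p : rPrin R v) : R) = φ p * (u' * u) := by
    conv_lhs => rw [hp, map_smul]
    rfl
  refine ⟨r * u', fun h0 => hu ?_⟩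
  have h1 : φ p = 0 := by
    apply Subtype.ext
    rw [h, hr, ZeroMemClass.coe_zero, ← h0]
    simp only [mul_assoc]
  have h2 : p = 0 := hφ (h1.trans (map_zero φ).symm)
  exact congrArg Subtype.val h2

/-- A regular ring satisfying the comparability axiom is prime. -/
theorem exists_mul_mul_ne_zero {R : Type*} [Ring R]
    (hvnr : ∀ x : R, ∃ y : R, x = x * y * x)
    (hcomp : ∀ u v : R,
      (∃ φ : rPrin R u →ₗ[Rᵐᵒᵖ] rPrin R v, Function.Injective φ) ∨
      (∃ φ : rPrin R v →ₗ[Rᵐᵒᵖ] rPrin R u, Function.Injective φ))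
    {u v : R} (hu : u ≠ 0) (hv : v ≠ 0) : ∃ y, u * y * v ≠ 0 := by
  rcases hcomp u v with ⟨φ, hφ⟩ | ⟨φ, hφ⟩
  · obtain ⟨r, hr⟩ := exists_mul_mul_ne_zero_of_injective hvnr hu φ hφ
    obtain ⟨n, hn⟩ := hvnr (v * r * u)
    refine ⟨n, fun h0 => hr ?_⟩
    have : v * r * u * n * (v * r * u) = v * r * (u * n * v) * (r * u) := by
      simp only [mul_assoc]
    rw [hn, this, h0, mul_zero, zero_mul]
  · exact exists_mul_mul_ne_zero_of_injective hvnr hv φ hφ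

/-- If `a` is not idempotent, then its right annihilator contains `eR` for some idempotent `e`
that annihilates `rfix(a)` but not `a`. -/
theorem exists_idempotent_of_not_idempotent {R : Type*} [Ring R]
    (hvnr : ∀ x : R, ∃ y : R, x = x * y * x)
    (hprime : ∀ u v : R, u ≠ 0 → v ≠ 0 → ∃ y, u * y * v ≠ 0)
    {a x : R} (hx : x ≠ 0) (hax : a * x = 0) (ha : a * a ≠ a) :
    ∃ e : R, e * e = e ∧ a * e = 0 ∧ (∀ y, a * y = y → e * y = 0) ∧ e * a ≠ 0 := by
  obtain ⟨f, hff, haf, hf⟩ : ∃ f : R, f * f = f ∧ a * f = f ∧ ∀ y, a * y = y → f * y = y := by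
    obtain ⟨s, hs⟩ := hvnr (1 - a)
    have hfix : ∀ y, a * y = y → (1 - s * (1 - a)) * y = y := fun y hy => by
      rw [sub_mul, mul_assoc, sub_mul 1 a, hy]
      simp
    have h : a * (1 - s * (1 - a)) = 1 - s * (1 - a) := by
      have h0 : (1 - a) * (1 - s * (1 - a)) = 0 := by
        rw [mul_sub, ← mul_assoc, ← hs]
        simp
      rw [sub_mul, one_mul] at h0
      exact (sub_eq_zero.1 h0).symm
    exact ⟨_, hfix _ h, h, hfix⟩
  -- a quasi-inverse of `a` acting as the identity on `rfix(a)`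
  obtain ⟨a', haa, haf'⟩ : ∃ a' : R, a * a' * a = a ∧ a' * f = f := by
    obtain ⟨s, hs⟩ := hvnr a
    have hsf : a * s * f = f := by
      conv_lhs => rw [← haf, ← mul_assoc, ← hs, haf]
    refine ⟨s + (1 - s) * f, ?_, ?_⟩
    · have : a * (s + (1 - s) * f) = a * s + (a * f - a * s * f) := by noncomm_ring
      rw [this, haf, hsf, sub_self, add_zero, ← hs]
    · have : (s + (1 - s) * f) * f = s * f + (f * f - s * (f * f)) := by noncomm_ring
      rw [this, hff]
      abel
  have hag : a * (1 - a' * a) = 0 := by rw [mul_sub, ← mul_assoc, haa, mul_one, sub_self]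
  have hgf : (1 - a' * a) * f = 0 := by rw [sub_mul, mul_assoc, haf, haf', one_mul, sub_self]
  have hgx : (1 - a' * a) * x = x := by rw [sub_mul, mul_assoc, hax]; simp
  have hgg : (1 - a' * a) * (1 - a' * a) = 1 - a' * a := by
    conv_lhs => rw [sub_mul, mul_assoc, hag]
    simp
  generalize 1 - a' * a = g at hag hgf hgx hgg
  have hkill : ∀ y, a * y = y → g * y = 0 := fun y hy => by
    rw [← hf y hy, ← mul_assoc, hgf, zero_mul]
  by_cases hga : g * a = 0
  · have hg : g ≠ 0 := by
      rintro rfl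
      exact hx (by simpa using hgx.symm)
    have hfa : (1 - f) * a ≠ 0 := fun h0 => ha (by
      rw [sub_mul, one_mul, sub_eq_zero] at h0
      have h1 : a * (f * a) = f * a := by rw [← mul_assoc, haf]
      rwa [← h0] at h1)
    obtain ⟨y, hy⟩ := hprime _ _ hg hfa
    refine ⟨g + g * y * ((1 - f) * (1 - g)), ?_, ?_, ?_, ?_⟩
    · have : (g + g * y * ((1 - f) * (1 - g))) * (g + g * y * ((1 - f) * (1 - g)))
          = g * g + g * g * y * ((1 - f) * (1 - g))
            + g * y * (1 - f) * (g - g * g) * (1 + y * ((1 - f) * (1 - g))) := by noncomm_ring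
      rw [this, hgg]
      simp
    · have : a * (g + g * y * ((1 - f) * (1 - g)))
          = a * g + a * g * y * ((1 - f) * (1 - g)) := by noncomm_ring
      rw [this, hag]
      simp
    · intro z hz
      have : (g + g * y * ((1 - f) * (1 - g))) * z
          = g * z + g * y * ((z - f * z) - (1 - f) * (g * z)) := by noncomm_ring
      rw [this, hkill z hz, hf z hz]
      simp
    · have : (g + g * y * ((1 - f) * (1 - g))) * a
          = g * a + g * y * ((1 - f) * a) - g * y * (1 - f) * (g * a) := by noncomm_ring
      rw [this, hga]
      simpa using hy
  · exact ⟨g, hgg, hag, hkill, hga⟩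

/-- Let `R` be a Dedekind-finite, von Neumann regular ring satisfying
the comparability axiom, and `R^#` its monoid of zero divisors, with the rFix-preorder.
If `a ∈ R^#` is an rFix-irreducible (of degree 2) of `R^#`, then `a` is a coprimitive
idempotent of `R`. -/
theorem rFix_irreducible_coprimitive_idempotent_of_vnr
    {R : Type*} [Ring R] [Nontrivial R]
    (hdf : ∀ x y : R, x * y = 1 → y * x = 1)
    (hvnr : ∀ x : R, ∃ y : R, x = x * y * x)
    (hcomp : ∀ u v : R,
      (∃ φ : rPrin R u →ₗ[Rᵐᵒᵖ] rPrin R v, Function.Injective φ) ∨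
      (∃ φ : rPrin R v →ₗ[Rᵐᵒᵖ] rPrin R u, Function.Injective φ))
    (a : R) (haH : IsZDOrOne R a)
    (hnu : ¬ IsRFixUnit R a)
    (hirr : ¬ ∃ b c : R, IsZDOrOne R b ∧ IsZDOrOne R c ∧
      ¬ IsRFixUnit R b ∧ ¬ IsRFixUnit R c ∧
      rFix R a < rFix R b ∧ rFix R a < rFix R c ∧ a = b * c) :
    a * a = a ∧ IndecRId (rAnn R a) := by
  have ha1 : a ≠ 1 := fun h => hnu (isRFixUnit_iff.2 h)
  obtain ⟨⟨x, hx, hax⟩, y, hy, hya⟩ := haH.resolve_right ha1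
  have haa : a * a = a := by
    by_contra haa
    obtain ⟨e, hee, hae, hkill, hea⟩ := exists_idempotent_of_not_idempotent hvnr
      (fun _ _ => exists_mul_mul_ne_zero hvnr hcomp) hx hax haa
    have he : e ≠ 0 := fun h => hea (by rw [h, zero_mul])
    obtain ⟨s, hs⟩ := hvnr (e * a)
    generalize ht : e * a = t at hea hs
    have hew : e * (a * s * t) = t := by rw [← mul_assoc, ← mul_assoc, ht, ← hs]
    have hyb : ∀ r, y * (a * r) = 0 := fun r => by rw [← mul_assoc, hya, zero_mul]
    refine hirr ⟨a * (1 + (1 - a) * s * t * s * e), 1 - e,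
      isZDOrOne_of_mul_eq_zero hdf hvnr hy (hyb _),
      isZDOrOne_of_mul_eq_zero hdf hvnr he (by rw [mul_sub, hee, mul_one, sub_self]),
      fun h => hy ?_, fun h => he ?_,
      rFix_lt (w := a * s * t) ?_ ?_ ?_, rFix_lt (w := 1 - e) ?_ ?_ ?_, ?_⟩
    · have := hyb (1 + (1 - a) * s * t * s * e)
      rwa [isRFixUnit_iff.1 h, mul_one] at this
    · simpa using isRFixUnit_iff.1 h
    · intro z hz
      have : a * (1 + (1 - a) * s * t * s * e) * z
          = a * z + a * (1 - a) * s * t * s * (e * z) := by noncomm_ring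
      rw [this, hkill z hz, hz]
      simp
    · have : a * (1 + (1 - a) * s * t * s * e) * (a * s * t)
          = a * (a * s * t) + a * (1 - a) * s * t * s * (e * (a * s * t)) := by noncomm_ring
      rw [this, hew]
      have : a * (1 - a) * s * t * s * t = a * (1 - a) * s * (t * s * t) := by noncomm_ring
      rw [this, ← hs]
      noncomm_ring
    · intro h
      exact hea (hew.symm.trans (hkill _ h))
    · intro z hz
      rw [sub_mul, hkill z hz]
      simp
    · rw [mul_sub, sub_mul, sub_mul, hee]
      simp
    · intro h
      rw [mul_sub, hae, mul_one, sub_zero] at h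
      apply haa
      nth_rw 2 [h]
      rw [mul_sub, hae, mul_one, sub_zero]
    · have : a * (1 + (1 - a) * s * t * s * e) * (1 - e)
          = a - a * e + a * (1 - a) * s * t * s * (e - e * e) := by noncomm_ring
      rw [this, hae, hee]
      simp
  refine ⟨haa, fun h => hx ?_, ?_⟩
  · have : x ∈ rAnn R a := hax
    rwa [h, Submodule.mem_bot] at this
  rintro ⟨N₁, N₂, h₁, h₂, hinf, hsup⟩
  have hmem : 1 - a ∈ N₁ ⊔ N₂ := by
    rw [hsup, mem_rAnn, mul_sub, haa, mul_one, sub_self]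
  obtain ⟨n₁, hn₁, n₂, hn₂, hn⟩ := Submodule.mem_sup.1 hmem
  have hsum : ∀ z, a * z = 0 → n₁ * z + n₂ * z = z := fun z hz => by
    rw [← add_mul, hn, sub_mul, hz]
    simp
  have hN₁ : ∀ z ∈ N₁, a * z = 0 := fun z hz =>
    mem_rAnn.1 (hsup ▸ Submodule.mem_sup_left hz)
  have hN₂ : ∀ z ∈ N₂, a * z = 0 := fun z hz =>
    mem_rAnn.1 (hsup ▸ Submodule.mem_sup_right hz)
  have hdisj : ∀ z ∈ N₁, z ∈ N₂ → z = 0 := fun z hz hz' =>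
    (Submodule.mem_bot _).1 (hinf ▸ Submodule.mem_inf.2 ⟨hz, hz'⟩)
  have hmul₁ : ∀ z, n₁ * z ∈ N₁ := fun z => N₁.smul_mem (MulOpposite.op z) hn₁
  have hmul₂ : ∀ z, n₂ * z ∈ N₂ := fun z => N₂.smul_mem (MulOpposite.op z) hn₂
  have hz₁ : ∀ z ∈ N₁, n₂ * z = 0 := fun z hz => hdisj _ (by
    rw [← sub_eq_of_eq_add' (hsum z (hN₁ z hz)).symm]
    exact N₁.sub_mem hz (hmul₁ z)) (hmul₂ z)
  have hz₂ : ∀ z ∈ N₂, n₁ * z = 0 := fun z hz => hdisj _ (hmul₁ z) (by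
    rw [← sub_eq_of_eq_add (hsum z (hN₂ z hz)).symm]
    exact N₂.sub_mem hz (hmul₂ z))
  have hid₁ : n₁ * n₁ = n₁ := by simpa [hz₁ n₁ hn₁] using hsum n₁ (hN₁ _ hn₁)
  have hid₂ : n₂ * n₂ = n₂ := by simpa [hz₂ n₂ hn₂] using hsum n₂ (hN₂ _ hn₂)
  have hne₁ : n₁ ≠ 0 := fun h0 => h₁ ((Submodule.eq_bot_iff _).2 fun z hz => by
    simpa [h0, hz₁ z hz] using (hsum z (hN₁ z hz)).symm)
  have hne₂ : n₂ ≠ 0 := fun h0 => h₂ ((Submodule.eq_bot_iff _).2 fun z hz => by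
    simpa [h0, hz₂ z hz] using (hsum z (hN₂ z hz)).symm)
  have ha : a = 1 - (n₁ + n₂) := by rw [hn, sub_sub_cancel]
  have hfix₁ : ∀ z, a * z = z → n₁ * z = 0 := fun z hz => by
    rw [← hz, ha, ← mul_assoc, mul_sub, mul_add, hid₁, hz₂ n₂ hn₂]
    simp
  have hfix₂ : ∀ z, a * z = z → n₂ * z = 0 := fun z hz => by
    rw [← hz, ha, ← mul_assoc, mul_sub, mul_add, hid₂, hz₁ n₁ hn₁]
    simp
  refine hirr ⟨1 - n₁, 1 - n₂,
    isZDOrOne_of_mul_eq_zero hdf hvnr hne₁ (by rw [mul_sub, hid₁, mul_one, sub_self]),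
    isZDOrOne_of_mul_eq_zero hdf hvnr hne₂ (by rw [mul_sub, hid₂, mul_one, sub_self]),
    fun h => hne₁ (by simpa using isRFixUnit_iff.1 h),
    fun h => hne₂ (by simpa using isRFixUnit_iff.1 h),
    rFix_lt (w := n₂) (fun z hz => by simp [sub_mul, hfix₁ z hz])
      (by simp [sub_mul, hz₂ n₂ hn₂]) (fun h => hne₂ (by rw [← h, hN₂ _ hn₂])),
    rFix_lt (w := n₁) (fun z hz => by simp [sub_mul, hfix₂ z hz])
      (by simp [sub_mul, hz₁ n₁ hn₁]) (fun h => hne₁ (by rw [← h, hN₁ _ hn₁])), ?_⟩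
  rw [mul_sub, sub_mul, sub_mul, hz₂ n₂ hn₂, ha]
  noncomm_ring
end

section
/- Let K be a division ring (possibly noncommutative), V a K-vector space of finite dimension n ≥ 1, and R = End(V) its endomorphism ring. Every non-injective (equivalently, singular) endomorphism f of V factors as a product of at most hgt(f) idempotent endomorphisms whose ranges have dimension n−1, where hgt(f) is the rFix-height of f relative to the monoid of zero divisors R^# of R. -/
/-- `rfix(a) = {x : a*x = x}` in a monoid (e.g. the multiplicative monoid of a ring). -/
def rFixM {R : Type*} [Monoid R] (a : R) : Set R := {x | a * x = x}

/-- `a` is a unit for the rFix-preorder (`x ⪯ y` iff `rfix(y) ⊆ rfix(x)`):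
`a ⪯ 1` and `1 ⪯ a`. -/
def IsRFixUnitM {R : Type*} [Monoid R] (a : R) : Prop :=
  rFixM (1 : R) ⊆ rFixM a ∧ rFixM a ⊆ rFixM (1 : R)

/-- The rFix-height of `x` relative to a subset `S` (e.g. a submonoid) of `R`: the
supremum in `ℕ∞` (with `sSup ∅ = 0`) of the set of integers `m ≥ 1` for which there
are `⪯`-non-units `x₁, …, x_m ∈ S` with `x₁ = x` and `x_{k+1} ≺ x_k` (i.e.
`rfix(x_k) ⊊ rfix(x_{k+1})`) for `1 ≤ k ≤ m-1`. -/
noncomputable def rFixHgtM {R : Type*} [Monoid R] (S : Set R) (x : R) : ℕ∞ :=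
  sSup ((fun m : ℕ => (m : ℕ∞)) ''
    {m : ℕ | 1 ≤ m ∧ ∃ g : ℕ → R, g 1 = x ∧
      (∀ i, 1 ≤ i → i ≤ m → g i ∈ S ∧ ¬ IsRFixUnitM (g i)) ∧
      (∀ i, 1 ≤ i → i < m → rFixM (g i) ⊂ rFixM (g (i + 1)))})

section Factorization

variable {K V : Type*} [DivisionRing K] [AddCommGroup V] [Module K V]

/-- Two vectors outside a subspace are separated from it by a single linear form. -/
theorem Submodule.exists_le_ker_of_notMem_of_notMem {p : Submodule K V} {a b : V}
    (ha : a ∉ p) (hb : b ∉ p) :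
    ∃ φ : V →ₗ[K] K, p ≤ LinearMap.ker φ ∧ φ a ≠ 0 ∧ φ b ≠ 0 := by
  obtain ⟨φ, hφa, hφ⟩ := Submodule.exists_le_ker_of_notMem ha
  obtain ⟨ψ, hψb, hψ⟩ := Submodule.exists_le_ker_of_notMem hb
  by_cases h1 : φ b = 0
  · by_cases h2 : ψ a = 0
    · refine ⟨φ + ψ, fun x hx ↦ ?_, by simpa [h2] using hφa, by simpa [h1] using hψb⟩
      simp [LinearMap.mem_ker.1 (hφ hx), LinearMap.mem_ker.1 (hψ hx)]
    · exact ⟨ψ, hψ, h2, hψb⟩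
  · exact ⟨φ, hφ, hφa, h1⟩

theorem finrank_range_of_ker_eq_span_singleton [FiniteDimensional K V]
    {e : Module.End K V} {k : V} (hk : k ≠ 0) (he : LinearMap.ker e = K ∙ k) :
    Module.finrank K (LinearMap.range e) = Module.finrank K V - 1 := by
  have h := LinearMap.finrank_range_add_finrank_ker e
  rw [he, finrank_span_singleton hk] at h
  omega

/-- The projection `x ↦ x - φ x • k` along `k` onto `ker φ`. -/
theorem coprimitive_idempotent_of_apply_eq_one [FiniteDimensional K V]
    {φ : V →ₗ[K] K} {k : V} (hk : φ k = 1) :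
    (1 - (LinearMap.toSpanSingleton K V k).comp φ : Module.End K V) *
        (1 - (LinearMap.toSpanSingleton K V k).comp φ) =
      1 - (LinearMap.toSpanSingleton K V k).comp φ ∧
    Module.finrank K
        (LinearMap.range (1 - (LinearMap.toSpanSingleton K V k).comp φ : Module.End K V)) =
      Module.finrank K V - 1 := by
  have hk0 : k ≠ 0 := by rintro rfl; simp at hk
  refine ⟨by ext x; simp [hk], finrank_range_of_ker_eq_span_singleton hk0 ?_⟩
  ext x
  simp only [LinearMap.mem_ker, Submodule.mem_span_singleton, LinearMap.sub_apply,
    Module.End.one_apply, LinearMap.comp_apply, LinearMap.toSpanSingleton_apply, sub_eq_zero]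
  constructor
  · exact fun h ↦ ⟨φ x, h.symm⟩
  · rintro ⟨c, rfl⟩
    simp [hk]

/-- A perturbation of `f` by a rank one map which fixes `r` in addition to the fixed points
of `f`, and from which `f` is recovered by composing with a projection along `k ∈ ker f`. -/
theorem factor_through_coprimitive_idempotent {f : Module.End K V} {φ : V →ₗ[K] K} {k r : V}
    (hfk : f k = 0) (hr : φ r = 1)
    (hφ : LinearMap.eqLocus f 1 ≤ LinearMap.ker φ) :
    let g : Module.End K V := f + (LinearMap.toSpanSingleton K V (r - f r)).comp φ
    (φ k = 1 → f = g * (1 - (LinearMap.toSpanSingleton K V k).comp φ)) ∧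
      LinearMap.eqLocus f 1 < LinearMap.eqLocus g 1 ∧ rFixM f ⊂ rFixM g := by
  intro g
  have hg : ∀ x, g x = f x + φ x • (r - f r) := fun x ↦ by simp [g]
  have hfg : ∀ x, f x = x → g x = x := fun x hx ↦ by
    have : φ x = 0 := hφ (by simpa using hx)
    rw [hg, this, zero_smul, add_zero, hx]
  have hgr : g r = r := by simp [hg, hr]
  have hfr : f r ≠ r := fun h ↦ by
    have : φ r = 0 := hφ (by simpa using h)
    simp [hr] at this
  refine ⟨fun hk ↦ ?_, ?_, ?_⟩
  · ext x
    simp [hg, hk, hfk]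
  · refine SetLike.lt_iff_le_and_exists.2 ⟨fun x hx ↦ ?_, r, by simpa using hgr, by simpa using hfr⟩
    simpa using hfg x (by simpa using hx)
  · refine (Set.ssubset_iff_of_subset fun x hx ↦ ?_).2
      ⟨(LinearMap.toSpanSingleton K V r).comp φ, ?_, fun h ↦ hfr ?_⟩
    · exact LinearMap.ext fun v ↦ hfg _ (LinearMap.congr_fun (show f * x = x from hx) v)
    · exact LinearMap.ext fun v ↦ by simp [hgr]
    · simpa [hr] using LinearMap.congr_fun
        (show f * ((LinearMap.toSpanSingleton K V r).comp φ) =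
          (LinearMap.toSpanSingleton K V r).comp φ from h) r

theorem coprimitive_idempotent_or_exists_factor [FiniteDimensional K V]
    {f : Module.End K V} (hf : ¬ Function.Injective f) :
    (f * f = f ∧ Module.finrank K (LinearMap.range f) = Module.finrank K V - 1) ∨
    ∃ g e : Module.End K V, ¬ Function.Injective g ∧
      (e * e = e ∧ Module.finrank K (LinearMap.range e) = Module.finrank K V - 1) ∧
      f = g * e ∧ LinearMap.eqLocus f 1 < LinearMap.eqLocus g 1 ∧ rFixM f ⊂ rFixM g := by
  obtain ⟨k, hfk, hk0⟩ : ∃ k, f k = 0 ∧ k ≠ 0 := by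
    simpa [injective_iff_map_eq_zero] using hf
  have hk : k ∉ LinearMap.eqLocus f 1 := by simpa [hfk] using hk0.symm
  by_cases hidem : ∀ x, f (f x) = f x
  · by_cases hker : LinearMap.ker f ≤ K ∙ k
    · left
      refine ⟨LinearMap.ext hidem, finrank_range_of_ker_eq_span_singleton hk0
        (hker.antisymm ?_)⟩
      simpa using hfk
    · right
      obtain ⟨k', hfk', hk'⟩ := SetLike.not_le_iff_exists.1 hker
      obtain ⟨φ, hφk, hφ⟩ := Submodule.exists_le_ker_of_notMem hk
      have hfc : f ((φ k)⁻¹ • k) = 0 := by simp [hfk]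
      have hc : φ ((φ k)⁻¹ • k) = 1 := by simp [hφk]
      obtain ⟨h1, h2⟩ := factor_through_coprimitive_idempotent hfc hc hφ
      refine ⟨_, _, fun hinj ↦ hk' ?_, coprimitive_idempotent_of_apply_eq_one hc, h1 hc, h2⟩
      have : k' - φ k' • (φ k)⁻¹ • k = 0 := hinj (by simp [hφk, hfk, LinearMap.mem_ker.1 hfk'])
      rw [sub_eq_zero.1 this]
      exact Submodule.smul_mem _ _ (Submodule.smul_mem _ _ (Submodule.mem_span_singleton_self k))
  · right
    push Not at hidem
    obtain ⟨y, hy⟩ := hidem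
    obtain ⟨φ, hφ, hφk, hφr⟩ := Submodule.exists_le_ker_of_notMem_of_notMem hk
      (show f y ∉ LinearMap.eqLocus f 1 by simpa using hy)
    have hfc : f ((φ k)⁻¹ • k) = 0 := by simp [hfk]
    have hc : φ ((φ k)⁻¹ • k) = 1 := by simp [hφk]
    have hr : φ ((φ (f y))⁻¹ • f y) = 1 := by simp [hφr]
    obtain ⟨h1, h2⟩ := factor_through_coprimitive_idempotent hfc hr hφ
    refine ⟨_, _, fun hinj ↦ hf (LinearMap.injective_iff_surjective.2 fun v ↦ ?_),
      coprimitive_idempotent_of_apply_eq_one hc, h1 hc, h2⟩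
    obtain ⟨x, rfl⟩ := LinearMap.injective_iff_surjective.1 hinj v
    exact ⟨x + φ x • ((φ (f y))⁻¹ • y - (φ (f y))⁻¹ • f y), by simp⟩

/-- A factorization together with a strictly `⪯`-decreasing chain of the same length. -/
theorem exists_factorization_and_rFix_chain [FiniteDimensional K V]
    (f : Module.End K V) (hf : ¬ Function.Injective f) :
    ∃ l : List (Module.End K V),
      (∀ e ∈ l, e * e = e ∧
        Module.finrank K (LinearMap.range e) = Module.finrank K V - 1) ∧
      l.prod = f ∧ 1 ≤ l.length ∧
      ∃ g : ℕ → Module.End K V, g 1 = f ∧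
        (∀ i, 1 ≤ i → i ≤ l.length → ¬ Function.Injective (g i)) ∧
        (∀ i, 1 ≤ i → i < l.length → rFixM (g i) ⊂ rFixM (g (i + 1))) := by
  induction hW : LinearMap.eqLocus f 1 using WellFoundedGT.induction generalizing f with
  | ind W ih =>
    subst hW
    rcases coprimitive_idempotent_or_exists_factor hf with h | ⟨g, e, hg, he, hfge, hlt, hss⟩
    · refine ⟨[f], by simpa using h, by simp, by simp, fun _ ↦ f, rfl, fun _ _ _ ↦ hf, ?_⟩
      intro i h1 h2
      simp at h2
      omega
    · obtain ⟨l, hl, hprod, hlen, c, hc1, hc, hcs⟩ := ih _ hlt g hg rfl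
      refine ⟨l ++ [e], ?_, by simp [hprod, hfge], by simp,
        fun i ↦ if i ≤ 1 then f else c (i - 1), by simp, ?_, ?_⟩
      · intro x hx
        rcases List.mem_append.1 hx with hx | hx
        · exact hl x hx
        · rwa [List.mem_singleton.1 hx]
      · intro i h1 h2
        simp only [List.length_append, List.length_singleton] at h2
        by_cases hi : i ≤ 1
        · simpa [hi] using hf
        · simpa [hi] using hc (i - 1) (by omega) (by omega)
      · intro i h1 h2
        simp only [List.length_append, List.length_singleton] at h2
        obtain rfl | hi := h1.eq_or_lt
        · simpa [hc1] using hss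
        · obtain ⟨j, rfl⟩ : ∃ j, i = j + 1 := ⟨i - 1, by omega⟩
          have hj : j ≠ 0 := by omega
          simpa [hj] using hcs j (by omega) (by omega)

end Factorization

/-- Let `V` be an `n`-dimensional vector space (`n ≥ 1`) over a
division ring `K` and `R = End(V)`. Every non-injective endomorphism `f` of `V` is a
product of at most `hgt(f)` idempotent endomorphisms whose ranges have dimension
`n - 1`, where `hgt(f)` is the rFix-height of `f` relative to the monoid `R^#` of zero
divisors of `R` (the identity together with the non-injective endomorphisms). -/
theorem singular_endomorphism_factors_into_coprimitive_idempotents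
    {K V : Type*} [DivisionRing K] [AddCommGroup V] [Module K V]
    [FiniteDimensional K V] (n : ℕ) (hn : Module.finrank K V = n) (h1 : 1 ≤ n)
    (f : Module.End K V) (hf : ¬ Function.Injective f) :
    ∃ l : List (Module.End K V),
      (∀ e ∈ l, e * e = e ∧ Module.finrank K (LinearMap.range e) = n - 1) ∧
      l.prod = f ∧
      (l.length : ℕ∞) ≤
        rFixHgtM {g : Module.End K V | ¬ Function.Injective g ∨ g = 1} f := by
  subst hn
  obtain ⟨l, hl, hprod, hlen, g, hg1, hg, hgs⟩ := exists_factorization_and_rFix_chain f hf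
  refine ⟨l, hl, hprod, le_sSup ⟨l.length, ⟨hlen, g, hg1, fun i h1 h2 ↦ ⟨.inl (hg i h1 h2), ?_⟩,
    hgs⟩, rfl⟩⟩
  intro hu
  have h : g i * 1 = 1 := hu.1 (mul_one (1 : Module.End K V))
  apply hg i h1 h2
  rw [← mul_one (g i), h]
  exact Function.injective_id
end

section
/- Let K be a division ring (possibly noncommutative) and V a K-vector space of finite dimension n ≥ 1. Every non-injective (equivalently, singular) linear endomorphism of V is a product of at most n idempotent endomorphisms whose ranges have dimension n−1. (Equivalently: every singular n-by-n matrix with entries in a skew field is a product of at most n idempotent matrices of rank n−1.) -/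
/-- If an endomorphism `D` of `H` maps some `z ≠ 0` to `c`, then a rank-one perturbation of `D`
in the direction `c` is singular. -/
lemma exists_dual_not_injective_add_smulRight {K H : Type*} [DivisionRing K] [AddCommGroup H]
    [Module K H] (D : Module.End K H) {z : H} (hz : z ≠ 0) :
    ∃ s : H →ₗ[K] K, ¬ Function.Injective (D + s.smulRight (D z)) := by
  obtain ⟨s, hs⟩ := (LinearMap.toSpanSingleton K H z).exists_leftInverse_of_injective
    (LinearMap.ker_toSpanSingleton K hz)
  have hsz : s z = 1 := by simpa using LinearMap.congr_fun hs 1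
  refine ⟨-s, fun hinj => hz (hinj ?_)⟩
  simp [hsz]

/-- For a singular endomorphism `f` there is a basis `b` such that `f (b j)` is always in the span
of the vectors `f (b k)`, `k < j`, and `b k`, `j < k`. -/
lemma exists_basis_apply_mem_span {K : Type*} [DivisionRing K] (n : ℕ) :
    ∀ {V : Type*} [AddCommGroup V] [Module K V] [FiniteDimensional K V]
      (_ : Module.finrank K V = n) (f : Module.End K V) (_ : 0 < n → ¬ Function.Injective f),
      ∃ b : Module.Basis (Fin n) K V, ∀ j, f (b j) ∈
        Submodule.span K ((fun k => f (b k)) '' {k | k < j} ∪ b '' {k | j < k}) := by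
  induction n with
  | zero =>
    intro V _ _ _ hV f _
    exact ⟨Module.finBasisOfFinrankEq K V hV, fun j => j.elim0⟩
  | succ n ih =>
    intro V _ _ _ hV f hf
    have hrange : LinearMap.range f < ⊤ := by
      rw [lt_top_iff_ne_top, Ne, LinearMap.range_eq_top, ← LinearMap.injective_iff_surjective]
      exact hf n.succ_pos
    obtain ⟨φ, hφ, hfφ⟩ := Submodule.exists_le_ker_of_lt_top _ hrange
    have hfφ' : ∀ v, φ (f v) = 0 := fun v => hfφ ⟨v, rfl⟩
    let H := LinearMap.ker φ
    have hH : Module.finrank K H = n := by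
      have h := φ.finrank_range_add_finrank_ker
      rw [LinearMap.range_eq_top.2 (LinearMap.surjective hφ), finrank_top, Module.finrank_self,
        hV] at h
      change 1 + Module.finrank K H = n + 1 at h
      omega
    let F : V →ₗ[K] H := f.codRestrict H hfφ'
    let D : Module.End K H := F.comp H.subtype
    obtain ⟨x₀, hx₀⟩ : ∃ x, φ x ≠ 0 := by
      by_contra! h
      exact hφ (LinearMap.ext h)
    obtain ⟨x, s, hx, hs⟩ : ∃ (x : V) (s : H →ₗ[K] K), φ x ≠ 0 ∧
        (0 < n → ¬ Function.Injective (D + s.smulRight (F x))) := by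
      by_cases hD : 0 < n ∧ Function.Injective D
      · obtain ⟨hn, hD⟩ := hD
        obtain ⟨x, hx, hFx⟩ : ∃ x, φ x ≠ 0 ∧ F x ≠ 0 := by
          by_cases h : F x₀ = 0
          · have : Nontrivial H := Module.nontrivial_of_finrank_pos (R := K) (hH ▸ hn)
            obtain ⟨y, hy⟩ := exists_ne (0 : H)
            refine ⟨x₀ + y, ?_, ?_⟩
            · rw [map_add, show φ y = 0 from y.2, add_zero]
              exact hx₀
            · rw [map_add, h, zero_add]
              exact (map_ne_zero_iff D hD).2 hy
          · exact ⟨x₀, hx₀, h⟩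
        obtain ⟨z, hz⟩ := LinearMap.injective_iff_surjective.1 hD (F x)
        have hz0 : z ≠ 0 := by
          rintro rfl
          exact hFx (by rw [← hz, map_zero])
        obtain ⟨s, hs⟩ := exists_dual_not_injective_add_smulRight D hz0
        exact ⟨x, s, hx, fun _ => hz ▸ hs⟩
      · refine ⟨x₀, 0, hx₀, fun hn hinj => hD ⟨hn, ?_⟩⟩
        simpa using hinj
    obtain ⟨b', hb'⟩ := ih hH (D + s.smulRight (F x)) hs
    let b : Module.Basis (Fin (n + 1)) K V := Module.Basis.mkFinCons x b'
      (fun c y hy h => by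
        have h' := congrArg φ h
        rw [map_add, map_smul, show φ y = 0 from hy, add_zero, map_zero, smul_eq_mul] at h'
        exact (mul_eq_zero.1 h').resolve_right hx)
      (fun v => ⟨-(φ v * (φ x)⁻¹), by
        change φ _ = 0
        simp [hx]⟩)
    have hb0 : b 0 = x := by simp [b]
    have hbs : ∀ i : Fin n, b i.succ = b' i := fun i => by simp [b]
    refine ⟨b, Fin.cases ?_ fun j => ?_⟩
    · have h : H.subtype (F x) ∈ (⊤ : Submodule K H).map H.subtype :=
        Submodule.mem_map_of_mem trivial
      rw [← b'.span_eq, Submodule.map_span] at h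
      rw [hb0]
      refine Submodule.span_mono ?_ h
      rintro _ ⟨_, ⟨i, rfl⟩, rfl⟩
      exact Or.inr ⟨i.succ, i.succ_pos, hbs i⟩
    · set S := Submodule.span K
        ((fun k => f (b k)) '' {k | k < j.succ} ∪ b '' {k | j.succ < k}) with hS
      have hxS : f x ∈ S := hb0 ▸ Submodule.subset_span (Or.inl ⟨0, j.succ_pos, rfl⟩)
      have hD : ∀ y : H, (((D + s.smulRight (F x)) y : H) : V) = f y + s y • f x := fun y => rfl
      have h := Submodule.mem_map_of_mem (f := H.subtype) (hb' j)
      have hle : Submodule.map H.subtype (Submodule.span K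
          ((fun k => (D + s.smulRight (F x)) (b' k)) '' {k | k < j} ∪ b' '' {k | j < k})) ≤ S := by
        rw [Submodule.map_span, Submodule.span_le]
        rintro _ ⟨_, ⟨k, hk, rfl⟩ | ⟨k, hk, rfl⟩, rfl⟩
        · change (((D + s.smulRight (F x)) (b' k) : H) : V) ∈ S
          rw [hD]
          refine S.add_mem (Submodule.subset_span (Or.inl ⟨k.succ, ?_, ?_⟩)) (S.smul_mem _ hxS)
          · exact Fin.succ_lt_succ_iff.2 hk
          · simp [hbs]
        · exact Submodule.subset_span (Or.inr ⟨k.succ, Fin.succ_lt_succ_iff.2 hk, hbs k⟩)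
      have h' := hle h
      change (((D + s.smulRight (F x)) (b' j) : H) : V) ∈ S at h'
      rw [hD] at h'
      rw [hbs]
      exact (S.add_mem_iff_left (S.smul_mem _ hxS)).1 h'

/-- The endomorphism replacing the basis vector `b m` by a vector in the span of the other basis
vectors is an idempotent of corank one. -/
lemma exists_idempotent_replacing_basis_vector {K V : Type*} [DivisionRing K] [AddCommGroup V]
    [Module K V] {n : ℕ} (b : Module.Basis (Fin n) K V) (m : Fin n) {a : V}
    (ha : a ∈ Submodule.span K (b '' {m}ᶜ)) :
    ∃ e : Module.End K V, e * e = e ∧ Module.finrank K (LinearMap.range e) = n - 1 ∧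
      e (b m) = a ∧ ∀ k ≠ m, e (b k) = b k := by
  classical
  let e : Module.End K V := b.constr ℕ (Function.update b m a)
  have hem : e (b m) = a := by simp [e]
  have hek : ∀ k ≠ m, e (b k) = b k := fun k hk => by simp [e, hk]
  have hfix : ∀ v ∈ Submodule.span K (b '' {m}ᶜ), e v = v := by
    intro v hv
    refine LinearMap.eqOn_span (f := e) (g := LinearMap.id) ?_ hv
    rintro _ ⟨k, hk, rfl⟩
    exact hek k hk
  have hrange : LinearMap.range e = Submodule.span K (b '' {m}ᶜ) := by
    refine le_antisymm ?_ fun v hv => ⟨v, hfix v hv⟩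
    rw [LinearMap.range_eq_map, ← b.span_eq, Submodule.map_span, Submodule.span_le]
    rintro _ ⟨_, ⟨k, rfl⟩, rfl⟩
    by_cases hk : k = m
    · subst hk
      rwa [hem]
    · rw [hek k hk]
      exact Submodule.subset_span ⟨k, hk, rfl⟩
  refine ⟨e, LinearMap.ext fun v => hfix _ (hrange ▸ LinearMap.mem_range_self e v), ?_, hem, hek⟩
  rw [hrange, Set.image_eq_range]
  have h := finrank_span_eq_card (b.linearIndependent.comp
    (Subtype.val : ({m}ᶜ : Set (Fin n)) → Fin n) Subtype.val_injective)
  simpa [Function.comp_def, Fintype.card_compl_set] using h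

/-- If `f (b j)` is always in the span of the vectors `f (b k)`, `k < j`, and `b k`, `j < k`, then
the endomorphism agreeing with `f` on the first `m` basis vectors and fixing the others is a product
of `m` idempotents of corank one. -/
lemma exists_list_idempotent_prod_apply_basis {K V : Type*} [DivisionRing K] [AddCommGroup V]
    [Module K V] {n : ℕ} (b : Module.Basis (Fin n) K V) (f : Module.End K V)
    (hb : ∀ j, f (b j) ∈
      Submodule.span K ((fun k => f (b k)) '' {k | k < j} ∪ b '' {k | j < k}))
    (m : ℕ) (hm : m ≤ n) :
    ∃ l : List (Module.End K V), l.length = m ∧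
      (∀ e ∈ l, e * e = e ∧ Module.finrank K (LinearMap.range e) = n - 1) ∧
      ∀ k : Fin n, l.prod (b k) = if k.val < m then f (b k) else b k := by
  induction m with
  | zero => exact ⟨[], by simp⟩
  | succ m ih =>
    obtain ⟨l, hl, hidem, hprod⟩ := ih (by omega)
    let i : Fin n := ⟨m, hm⟩
    have hle : Submodule.span K ((fun k => f (b k)) '' {k | k < i} ∪ b '' {k | i < k}) ≤
        (Submodule.span K (b '' {i}ᶜ)).map l.prod := by
      rw [Submodule.map_span]
      refine Submodule.span_mono ?_
      rintro _ (⟨k, hk, rfl⟩ | ⟨k, hk, rfl⟩)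
      · exact ⟨b k, ⟨k, ne_of_lt hk, rfl⟩, by rw [hprod, if_pos (Fin.lt_def.1 hk)]⟩
      · exact ⟨b k, ⟨k, ne_of_gt hk, rfl⟩, by rw [hprod, if_neg (Fin.lt_def.1 hk).not_gt]⟩
    obtain ⟨a, ha, hfa⟩ := hle (hb i)
    obtain ⟨e, he, her, hei, hek⟩ := exists_idempotent_replacing_basis_vector b i ha
    refine ⟨l ++ [e], by simp [hl], ?_, fun k => ?_⟩
    · intro e' he'
      rcases List.mem_append.1 he' with h | h
      · exact hidem e' h
      · rw [List.mem_singleton.1 h]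
        exact ⟨he, her⟩
    · rw [List.prod_append, List.prod_singleton, Module.End.mul_apply]
      by_cases hk : k = i
      · subst hk
        rw [hei, hfa, if_pos (Nat.lt_succ_self m)]
      · have hkm : k.val ≠ m := fun h => hk (Fin.ext h)
        rw [hek k hk, hprod]
        exact if_congr (by omega) rfl rfl

/-- Erdos–Dawlings for skew fields. Let `V` be an `n`-dimensional
vector space (`n ≥ 1`) over a division ring `K`. Every non-injective (singular) linear
endomorphism of `V` is a product of at most `n` idempotent endomorphisms whose ranges
have dimension `n - 1`. -/
theorem singular_endomorphism_product_of_n_idempotents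
    {K V : Type*} [DivisionRing K] [AddCommGroup V] [Module K V]
    [FiniteDimensional K V] (n : ℕ) (hn : Module.finrank K V = n) (h1 : 1 ≤ n)
    (f : Module.End K V) (hf : ¬ Function.Injective f) :
    ∃ l : List (Module.End K V), l.length ≤ n ∧
      (∀ e ∈ l, e * e = e ∧ Module.finrank K (LinearMap.range e) = n - 1) ∧
      l.prod = f := by
  obtain ⟨b, hb⟩ := exists_basis_apply_mem_span n hn f fun _ => hf
  obtain ⟨l, hl, hidem, hprod⟩ := exists_list_idempotent_prod_apply_basis b f hb n le_rfl
  exact ⟨l, hl.le, hidem, b.ext fun k => by rw [hprod, if_pos k.isLt]⟩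
end

section
/- Let M be a Rickart right module over a ring D, R = End(M), and f, g ∈ R. Then rfix(g) ⊆ rfix(f) (i.e., f ⪯ g in the rFix-preorder on R) if and only if fix(g) ⊆ fix(f), where fix(h) = {x ∈ M : h(x) = x} and rfix(h) = {α ∈ R : hα = α}. -/
/-- Let `M` be a Rickart module over a ring `D` (the kernel of every
endomorphism is a direct summand of `M`), `R = End(M)` and `f, g ∈ R`. Then
`rfix(g) ⊆ rfix(f)` (i.e. `f ⪯ g` in the rFix-preorder on `R`) if and only if
`fix(g) ⊆ fix(f)`. -/
theorem rfix_subset_iff_fix_subset_of_rickart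
    {D M : Type*} [Ring D] [AddCommGroup M] [Module D M]
    (hrick : ∀ h : Module.End D M, ∃ N : Submodule D M,
      LinearMap.ker h ⊓ N = ⊥ ∧ LinearMap.ker h ⊔ N = ⊤)
    (f g : Module.End D M) :
    ({α : Module.End D M | g * α = α} ⊆ {α : Module.End D M | f * α = α}) ↔
      ({x : M | g x = x} ⊆ {x : M | f x = x}) := by
  constructor
  · intro hsub x hx
    obtain ⟨N, hinf, hsup⟩ := hrick (g - 1)
    have hc : IsCompl (LinearMap.ker (g - 1)) N :=
      ⟨disjoint_iff.mpr hinf, codisjoint_iff.mpr hsup⟩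
    let p : Module.End D M := (LinearMap.ker (g - 1)).projection N hc
    have hg : g * p = p := by
      ext y
      have hy : p y ∈ LinearMap.ker (g - 1) := Submodule.projection_apply_mem hc y
      exact sub_eq_zero.mp hy
    have hf : f * p = p := hsub hg
    have hpx : p x = x :=
      Submodule.projection_apply_of_mem_left hc (sub_eq_zero.mpr hx)
    simpa [hpx] using LinearMap.congr_fun hf x
  · intro hsub α hα
    ext x
    exact hsub (LinearMap.congr_fun hα x)
end
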